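/- arXiv:2011.14741 — 3 statements merged into one kernel-verified Lean document; each statement's English description precedes it below -/
import Mathlib

section
/- Let W be a channel from a finite alphabet 𝒳 to a finite alphabet 𝒴, let Q be a distribution on 𝒴, let γ ∈ ℝ, and set S = S(Q,γ) = {(x,y) ∈ 𝒳×𝒴 : W(y|x) ≤ e^γ Q(y)}. Then for every integer M ≥ 1, every ε, δ ≥ 0, and every (N,ε,δ)-ID code for W with N > |𝒳|^M, it holds that ε + δ ≥ inf_{P} P×W(S) − √(e^γ/M), where the infimum is over all distributions P on 𝒳. -/
open Finset

/-- `p` is a probability distribution on a finite type. -/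
def IsDist {Z : Type*} [Fintype Z] (p : Z → ℝ) : Prop :=
  (∀ z, 0 ≤ p z) ∧ ∑ z, p z = 1

/-- `W` is a channel from `A` to `B`. -/
def IsChannel {A B : Type*} [Fintype A] [Fintype B] (W : A → B → ℝ) : Prop :=
  (∀ x y, 0 ≤ W x y) ∧ ∀ x, ∑ y, W x y = 1

/-- Output distribution `PW`. -/
noncomputable def outDist {A B : Type*} [Fintype A] (P : A → ℝ) (W : A → B → ℝ) (y : B) : ℝ :=
  ∑ x, P x * W x y

/-- Mass of a set under a (sub)distribution. -/
noncomputable def mass {Z : Type*} [Fintype Z] (p : Z → ℝ) (S : Set Z) : ℝ :=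
  ∑ z, S.indicator p z

/-- `P×W(S)`. -/
noncomputable def jointMass {A B : Type*} [Fintype A] [Fintype B]
    (P : A → ℝ) (W : A → B → ℝ) (S : Set (A × B)) : ℝ :=
  mass (fun z : A × B => P z.1 * W z.1 z.2) S

/-- Variational distance between (sub)distributions. -/
noncomputable def tvDist {Z : Type*} [Fintype Z] (p q : Z → ℝ) : ℝ :=
  (1 / 2) * ∑ z, |p z - q z|

/-- Partial response `PW^S`. -/
noncomputable def partialResp {A B : Type*} [Fintype A] [Fintype B]
    (P : A → ℝ) (W : A → B → ℝ) (S : Set (A × B)) (y : B) : ℝ :=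
  ∑ x, S.indicator (fun z : A × B => P z.1 * W z.1 z.2) (x, y)

/-- `p` is an `M`-type: every value is an integer multiple of `1/M`. -/
def IsMType {Z : Type*} [Fintype Z] (M : ℕ) (p : Z → ℝ) : Prop :=
  ∀ z, ∃ k : ℕ, p z = (k : ℝ) / M

/-- `(N, ε, δ)`-ID code for channel `W`. -/
structure IsIDCode {A B : Type*} [Fintype A] [Fintype B] (W : A → B → ℝ) (N : ℕ)
    (P : Fin N → A → ℝ) (D : Fin N → Set B) (ε δ : ℝ) : Prop where
  dist : ∀ i, IsDist (P i)
  typeI : ∀ i, mass (outDist (P i) W) (D i)ᶜ ≤ ε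
  typeII : ∀ i j, i ≠ j → mass (outDist (P i) W) (D j) ≤ δ

/-- Existence of an `(N, ε, δ)`-ID code for channel `W`. -/
def ExistsIDCode {A B : Type*} [Fintype A] [Fintype B] (W : A → B → ℝ) (N : ℕ) (ε δ : ℝ) : Prop :=
  ∃ (P : Fin N → A → ℝ) (D : Fin N → Set B), IsIDCode W N P D ε δ

/-- `ε`-information spectrum divergence `D_s^ε(p‖q)`. -/
noncomputable def Ds {Z : Type*} [Fintype Z] (α : ℝ) (p q : Z → ℝ) : ℝ :=
  sSup {γ : ℝ | mass p {z | p z ≤ Real.exp γ * q z} ≤ α}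

/-- Optimal type II error `β_ε(p,q)` of binary hypothesis testing. -/
noncomputable def betaErr {Z : Type*} [Fintype Z] (ε : ℝ) (p q : Z → ℝ) : ℝ :=
  sInf {v : ℝ | ∃ t : Z → ℝ, (∀ z, 0 ≤ t z ∧ t z ≤ 1) ∧
    (∑ z, p z * (1 - t z)) ≤ ε ∧ v = ∑ z, q z * t z}

/-- A function with average at most `B` takes some value at most `B`. -/
theorem IsDist.exists_le {A : Type*} [Fintype A] {P : A → ℝ} (hP : IsDist P) (F : A → ℝ) (B : ℝ)
    (h : ∑ x, P x * F x ≤ B) : ∃ x, F x ≤ B := by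
  by_contra! hlt
  have hnn : ∀ x ∈ univ, 0 ≤ P x * (F x - B) := fun x _ =>
    mul_nonneg (hP.1 x) (sub_nonneg.2 (hlt x).le)
  have hle : ∑ x, P x * (F x - B) ≤ 0 := by
    simp only [mul_sub, sum_sub_distrib, ← sum_mul, hP.2]
    linarith
  have hzero := (sum_eq_zero_iff_of_nonneg hnn).1 (le_antisymm hle (sum_nonneg hnn))
  have hP0 : ∀ x, P x = 0 := fun x =>
    (mul_eq_zero.1 (hzero x (mem_univ x))).resolve_right (sub_pos.2 (hlt x)).ne'
  simpa [hP0] using hP.2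

/-- Adding one sample to a deviation vector `d` increases its average weighted square norm
by at most `c`. -/
theorem sum_weighted_sq_add_le {A B : Type*} [Fintype A] [Fintype B] {P : A → ℝ} {Q : B → ℝ}
    {V : A → B → ℝ} {c : ℝ} (hP : IsDist P) (hQ : IsDist Q) (hc : 0 ≤ c)
    (hV0 : ∀ x y, 0 ≤ V x y) (hVQ : ∀ x y, V x y ≤ c * Q y) (hV1 : ∀ x, ∑ y, V x y ≤ 1)
    (d : B → ℝ) :
    ∑ x, P x * ∑ y, (d y + (V x y - outDist P V y)) ^ 2 / Q y ≤ (∑ y, d y ^ 2 / Q y) + c := by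
  have hy : ∀ y, ∑ x, P x * ((d y + (V x y - outDist P V y)) ^ 2 / Q y) ≤
      d y ^ 2 / Q y + c * ∑ x, P x * V x y := by
    intro y
    have hexp : ∑ x, P x * ((d y + (V x y - outDist P V y)) ^ 2 / Q y) =
        (d y ^ 2 + ∑ x, P x * V x y ^ 2 - outDist P V y ^ 2) / Q y := by
      have hterm : ∀ x, P x * ((d y + (V x y - outDist P V y)) ^ 2 / Q y) =
          (P x * (d y - outDist P V y) ^ 2 + P x * V x y * (2 * (d y - outDist P V y)) +
            P x * V x y ^ 2) / Q y := fun x => by ring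
      rw [sum_congr rfl fun x _ => hterm x, ← sum_div, sum_add_distrib, sum_add_distrib,
        ← sum_mul, ← sum_mul, hP.2, show ∑ x, P x * V x y = outDist P V y from rfl]
      ring
    rw [hexp]
    rcases (hQ.1 y).eq_or_lt with h0 | hpos
    · rw [← h0, div_zero, div_zero, zero_add]
      exact mul_nonneg hc (sum_nonneg fun x _ => mul_nonneg (hP.1 x) (hV0 x y))
    · have hsq : ∑ x, P x * V x y ^ 2 ≤ (c * ∑ x, P x * V x y) * Q y := by
        rw [mul_sum, sum_mul]
        refine sum_le_sum fun x _ => ?_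
        have := mul_le_mul_of_nonneg_left (hVQ x y) (mul_nonneg (hP.1 x) (hV0 x y))
        linarith
      rw [div_add' _ _ _ hpos.ne']
      gcongr
      linarith [sq_nonneg (outDist P V y)]
  calc ∑ x, P x * ∑ y, (d y + (V x y - outDist P V y)) ^ 2 / Q y
      = ∑ y, ∑ x, P x * ((d y + (V x y - outDist P V y)) ^ 2 / Q y) := by
        simp only [mul_sum]
        exact sum_comm
    _ ≤ ∑ y, (d y ^ 2 / Q y + c * ∑ x, P x * V x y) := sum_le_sum fun y _ => hy y
    _ = (∑ y, d y ^ 2 / Q y) + c * ∑ x, P x * ∑ y, V x y := by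
        rw [sum_add_distrib, ← mul_sum, sum_comm]
        simp only [mul_sum]
    _ ≤ (∑ y, d y ^ 2 / Q y) + c := by
        have : ∑ x, P x * ∑ y, V x y ≤ 1 := by
          rw [← hP.2]
          exact sum_le_sum fun x _ => mul_le_of_le_one_right (hP.1 x) (hV1 x)
        nlinarith

/-- Some `n` samples have a weighted square deviation at most `n * c`. -/
theorem exists_samples_weighted_sq_le {A B : Type*} [Fintype A] [Fintype B] {P : A → ℝ}
    {Q : B → ℝ} {V : A → B → ℝ} {c : ℝ} (hP : IsDist P) (hQ : IsDist Q) (hc : 0 ≤ c)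
    (hV0 : ∀ x y, 0 ≤ V x y) (hVQ : ∀ x y, V x y ≤ c * Q y) (hV1 : ∀ x, ∑ y, V x y ≤ 1)
    (n : ℕ) :
    ∃ f : Fin n → A, ∑ y, (∑ k, (V (f k) y - outDist P V y)) ^ 2 / Q y ≤ n * c := by
  induction n with
  | zero => exact ⟨Fin.elim0, by simp⟩
  | succ n ih =>
    obtain ⟨f, hf⟩ := ih
    obtain ⟨x, hx⟩ := hP.exists_le _ _ (sum_weighted_sq_add_le hP hQ hc hV0 hVQ hV1
      fun y => ∑ k, (V (f k) y - outDist P V y))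
    refine ⟨Fin.snoc f x, ?_⟩
    simp only [Fin.sum_univ_castSucc, Fin.snoc_castSucc, Fin.snoc_last]
    push_cast
    linarith

/-- Partial channel resolvability: some `M` samples approximate the output of the subchannel `V`
within `√(c / M)` in `ℓ¹` norm. -/
theorem exists_samples_l1_le {A B : Type*} [Fintype A] [Fintype B] {P : A → ℝ}
    {Q : B → ℝ} {V : A → B → ℝ} {c : ℝ} (hP : IsDist P) (hQ : IsDist Q) (hc : 0 ≤ c)
    (hV0 : ∀ x y, 0 ≤ V x y) (hVQ : ∀ x y, V x y ≤ c * Q y) (hV1 : ∀ x, ∑ y, V x y ≤ 1)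
    {M : ℕ} (hM : 1 ≤ M) :
    ∃ f : Fin M → A, ∑ y, |(∑ k, V (f k) y) / M - outDist P V y| ≤ Real.sqrt (c / M) := by
  obtain ⟨f, hf⟩ := exists_samples_weighted_sq_le hP hQ hc hV0 hVQ hV1 M
  refine ⟨f, Real.le_sqrt_of_sq_le ?_⟩
  have hMpos : (0 : ℝ) < M := by exact_mod_cast hM
  have hdev : ∀ y, |(∑ k, V (f k) y) / M - outDist P V y| =
      |∑ k, (V (f k) y - outDist P V y)| / M := by
    intro y
    rw [← abs_of_pos hMpos, ← abs_div, abs_of_pos hMpos]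
    congr 1
    simp only [sum_sub_distrib, sum_const, card_univ, Fintype.card_fin, nsmul_eq_mul]
    field_simp
  have hV : ∀ x y, Q y = 0 → V x y = 0 := fun x y h =>
    le_antisymm (by simpa [h] using hVQ x y) (hV0 x y)
  have hcs : (∑ y, |∑ k, (V (f k) y - outDist P V y)|) ^ 2 ≤
      (∑ y, (∑ k, (V (f k) y - outDist P V y)) ^ 2 / Q y) * ∑ y, Q y := by
    refine sum_sq_le_sum_mul_sum_of_sq_le_mul _
      (fun y _ => div_nonneg (sq_nonneg _) (hQ.1 y)) (fun y _ => hQ.1 y) fun y _ => ?_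
    rcases eq_or_ne (Q y) 0 with h0 | hne
    · simp [outDist, hV _ y h0]
    · rw [sq_abs, div_mul_cancel₀ _ hne]
  rw [hQ.2, mul_one] at hcs
  rw [sum_congr rfl fun y _ => hdev y, ← sum_div, div_pow, div_le_div_iff₀ (by positivity) hMpos]
  nlinarith [hcs.trans hf]

/-- The total mass of two functions is bounded by a test sum and their `ℓ¹` distance. -/
theorem sum_add_sum_le_test {B : Type*} [Fintype B] (a b : B → ℝ) (D : Set B) :
    ∑ y, a y + ∑ y, b y ≤ 2 * (mass a Dᶜ + mass b D) + ∑ y, |a y - b y| := by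
  simp only [mass]
  rw [← sum_add_distrib, ← sum_add_distrib, mul_sum, ← sum_add_distrib]
  refine sum_le_sum fun y _ => ?_
  by_cases hy : y ∈ D
  · simp only [Set.indicator, hy, Set.mem_compl_iff, not_true_eq_false, if_true, if_false]
    linarith [le_abs_self (a y - b y)]
  · simp only [Set.indicator, hy, Set.mem_compl_iff, not_false_eq_true, if_true, if_false]
    linarith [neg_abs_le (a y - b y)]

theorem mass_mono {Z : Type*} [Fintype Z] {p q : Z → ℝ} (h : ∀ z, p z ≤ q z) (S : Set Z) :
    mass p S ≤ mass q S :=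
  sum_le_sum fun z _ => Set.indicator_le_indicator (h z)

theorem jointMass_eq_sum_outDist {A B : Type*} [Fintype A] [Fintype B] (P : A → ℝ)
    (W : A → B → ℝ) (S : Set (A × B)) :
    jointMass P W S =
      ∑ y, outDist P (fun x y => S.indicator (fun z : A × B => W z.1 z.2) (x, y)) y := by
  classical
  simp only [jointMass, mass, outDist, Fintype.sum_prod_type]
  rw [sum_comm]
  refine sum_congr rfl fun y _ => sum_congr rfl fun x _ => ?_
  simp only [Set.indicator_apply, mul_ite, mul_zero]

theorem jointMass_nonneg {A B : Type*} [Fintype A] [Fintype B] {P : A → ℝ} {W : A → B → ℝ}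
    (hP : IsDist P) (hW : IsChannel W) (S : Set (A × B)) : 0 ≤ jointMass P W S :=
  sum_nonneg fun z _ =>
    Set.indicator_nonneg (fun z _ => mul_nonneg (hP.1 z.1) (hW.1 z.1 z.2)) z

/-- Minimax converse for identification via channels (Theorem 1). -/
theorem minimax_converse_for_ID
    {𝒳 𝒴 : Type*} [Fintype 𝒳] [Fintype 𝒴]
    (W : 𝒳 → 𝒴 → ℝ) (hW : IsChannel W)
    (Q : 𝒴 → ℝ) (hQ : IsDist Q) (γ : ℝ)
    (M : ℕ) (hM : 1 ≤ M) (ε δ : ℝ) (hε : 0 ≤ ε) (hδ : 0 ≤ δ)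
    (N : ℕ) (hN : Fintype.card 𝒳 ^ M < N)
    (P : Fin N → 𝒳 → ℝ) (D : Fin N → Set 𝒴)
    (hcode : IsIDCode W N P D ε δ) :
    sInf {v : ℝ | ∃ p : 𝒳 → ℝ, IsDist p ∧
        v = jointMass p W {z : 𝒳 × 𝒴 | W z.1 z.2 ≤ Real.exp γ * Q z.2}} -
      Real.sqrt (Real.exp γ / M) ≤ ε + δ := by
  set S : Set (𝒳 × 𝒴) := {z | W z.1 z.2 ≤ Real.exp γ * Q z.2}
  set I := sInf {v : ℝ | ∃ p : 𝒳 → ℝ, IsDist p ∧ v = jointMass p W S}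
  have hinf : ∀ i, I ≤ jointMass (P i) W S := fun i =>
    csInf_le ⟨0, by rintro _ ⟨p, hp, rfl⟩; exact jointMass_nonneg hp hW S⟩
      ⟨P i, hcode.dist i, rfl⟩
  set V : 𝒳 → 𝒴 → ℝ := fun x y => S.indicator (fun z : 𝒳 × 𝒴 => W z.1 z.2) (x, y)
  have hV0 : ∀ x y, 0 ≤ V x y := fun x y =>
    Set.indicator_nonneg (fun z _ => hW.1 z.1 z.2) (x, y)
  have hVW : ∀ x y, V x y ≤ W x y := fun x y =>
    Set.indicator_le_self' (f := fun z : 𝒳 × 𝒴 => W z.1 z.2) (fun z _ => hW.1 z.1 z.2) (x, y)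
  have hVQ : ∀ x y, V x y ≤ Real.exp γ * Q y := fun x y =>
    Set.indicator_apply_le' (fun h => h) fun _ => mul_nonneg (Real.exp_nonneg γ) (hQ.1 y)
  have hV1 : ∀ x, ∑ y, V x y ≤ 1 := fun x =>
    (sum_le_sum fun y _ => hVW x y).trans (hW.2 x).le
  choose f hf using fun i =>
    exists_samples_l1_le (hcode.dist i) hQ (Real.exp_nonneg γ) hV0 hVQ hV1 hM
  obtain ⟨i, j, hij, hfij⟩ := Fintype.exists_ne_map_eq_of_card_lt f (by simpa using hN)
  have hdist : ∑ y, |outDist (P i) V y - outDist (P j) V y| ≤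
      2 * Real.sqrt (Real.exp γ / M) := by
    have hi := hf i
    have hj := hf j
    rw [← hfij] at hj
    calc ∑ y, |outDist (P i) V y - outDist (P j) V y|
        ≤ ∑ y, (|(∑ k, V (f i k) y) / M - outDist (P i) V y| +
            |(∑ k, V (f i k) y) / M - outDist (P j) V y|) := by
          refine sum_le_sum fun y _ => ?_
          rw [abs_sub_comm ((∑ k, V (f i k) y) / M) (outDist (P i) V y)]
          exact abs_sub_le _ _ _
      _ ≤ 2 * Real.sqrt (Real.exp γ / M) := by
          rw [sum_add_distrib]
          linarith
  have hout : ∀ l y, outDist (P l) V y ≤ outDist (P l) W y := fun l y =>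
    sum_le_sum fun x _ => mul_le_mul_of_nonneg_left (hVW x y) ((hcode.dist l).1 x)
  have htest := sum_add_sum_le_test (outDist (P i) V) (outDist (P j) V) (D i)
  have hmi := jointMass_eq_sum_outDist (P i) W S
  have hmj := jointMass_eq_sum_outDist (P j) W S
  have h1 := (mass_mono (hout i) (D i)ᶜ).trans (hcode.typeI i)
  have h2 := (mass_mono (hout j) (D i)).trans (hcode.typeII j i hij.symm)
  linarith [hinf i, hinf j]
end

section
/- Let W be a channel from a finite alphabet 𝒳 to a finite alphabet 𝒴, let Q be a distribution on 𝒴, let γ ∈ ℝ, and set S = S(Q,γ) = {(x,y) ∈ 𝒳×𝒴 : W(y|x) ≤ e^γ Q(y)}. Then for every distribution P on 𝒳 and every integer M ≥ 1, there exists an M-type distribution P̃ on 𝒳 such that d(P̃W^S, PW^S) ≤ (1/2)√(e^γ/M). -/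
open Finset

/-- A quantity whose average against a distribution is at most `b` is somewhere at most `b`. -/
theorem IsDist.exists_le_of_sum_mul_le {A : Type*} [Fintype A] {P : A → ℝ} (hP : IsDist P)
    {G : A → ℝ} {b : ℝ} (h : ∑ x, P x * G x ≤ b) : ∃ x, G x ≤ b := by
  by_contra! hG
  have hz : ∑ x, P x * (G x - b) ≤ 0 := by
    simp only [mul_sub, sum_sub_distrib, ← sum_mul, hP.2]
    linarith
  have hnn : ∀ x ∈ (univ : Finset A), 0 ≤ P x * (G x - b) := fun x _ =>
    mul_nonneg (hP.1 x) (sub_pos.2 (hG x)).le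
  have h0 := (sum_eq_zero_iff_of_nonneg hnn).1 (le_antisymm hz (sum_nonneg hnn))
  have hP0 : ∀ x, P x = 0 := fun x =>
    (mul_eq_zero.1 (h0 x (mem_univ x))).resolve_right (sub_pos.2 (hG x)).ne'
  have := hP.2
  simp [hP0] at this

/-- Second moment of a shifted centred variable is at most the squared shift plus the
second moment. -/
theorem IsDist.sum_mul_sq_add_sub_mean_le {A : Type*} [Fintype A] {P : A → ℝ} (hP : IsDist P)
    (v : A → ℝ) (s : ℝ) :
    ∑ x, P x * (s + (v x - ∑ x', P x' * v x')) ^ 2 ≤ s ^ 2 + ∑ x, P x * v x ^ 2 := by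
  set m := ∑ x', P x' * v x' with hm
  have h : ∑ x, P x * (s + (v x - m)) ^ 2 =
      (s - m) ^ 2 * ∑ x, P x + 2 * (s - m) * ∑ x, P x * v x + ∑ x, P x * v x ^ 2 := by
    simp only [mul_sum, ← sum_add_distrib]
    exact sum_congr rfl fun x _ => by ring
  rw [h, hP.2, ← hm]
  nlinarith [sq_nonneg m]

/-- Greedy sampling: some `M` points have a sum of vectors within the weighted squared distance
`M * C` of `M` times the mean. -/
theorem IsDist.exists_counts_sum_sq_le {A B : Type*} [Fintype A] [Fintype B] {P : A → ℝ}
    (hP : IsDist P) (V : A → B → ℝ) (w : B → ℝ) (hw : ∀ y, 0 ≤ w y) {C : ℝ}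
    (hC : ∑ y, w y * ∑ x, P x * V x y ^ 2 ≤ C) (M : ℕ) :
    ∃ k : A → ℕ, ∑ x, k x = M ∧
      ∑ y, w y * (∑ x, (k x : ℝ) * V x y - M * ∑ x, P x * V x y) ^ 2 ≤ M * C := by
  classical
  induction M with
  | zero => exact ⟨0, by simp, by simp⟩
  | succ M ih =>
    obtain ⟨k, hk, hb⟩ := ih
    set s : B → ℝ := fun y => ∑ x, (k x : ℝ) * V x y - M * ∑ x, P x * V x y with hs
    have havg : ∑ x, P x * ∑ y, w y * (s y + (V x y - ∑ x', P x' * V x' y)) ^ 2 ≤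
        M * C + C := by
      calc ∑ x, P x * ∑ y, w y * (s y + (V x y - ∑ x', P x' * V x' y)) ^ 2
          = ∑ y, w y * ∑ x, P x * (s y + (V x y - ∑ x', P x' * V x' y)) ^ 2 := by
            simp only [mul_sum (s := (univ : Finset B))]
            rw [sum_comm]
            refine sum_congr rfl fun y _ => ?_
            rw [mul_sum]
            exact sum_congr rfl fun x _ => by ring
        _ ≤ ∑ y, w y * (s y ^ 2 + ∑ x, P x * V x y ^ 2) := by
            refine sum_le_sum fun y _ => mul_le_mul_of_nonneg_left ?_ (hw y)
            exact hP.sum_mul_sq_add_sub_mean_le (fun x => V x y) (s y)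
        _ ≤ M * C + C := by
            simp only [mul_add, sum_add_distrib]
            exact add_le_add hb hC
    obtain ⟨x₀, hx₀⟩ := hP.exists_le_of_sum_mul_le havg
    refine ⟨fun x => k x + if x = x₀ then 1 else 0, by simp [sum_add_distrib, hk], ?_⟩
    have hsum : ∀ y, ∑ x, ((k x + if x = x₀ then 1 else 0 : ℕ) : ℝ) * V x y =
        ∑ x, (k x : ℝ) * V x y + V x₀ y := fun y => by
      simp [add_mul, sum_add_distrib]
    calc _ = ∑ y, w y * (s y + (V x₀ y - ∑ x', P x' * V x' y)) ^ 2 := by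
          refine sum_congr rfl fun y _ => ?_
          rw [hsum, hs]
          push_cast
          ring
      _ ≤ M * C + C := hx₀
      _ = _ := by push_cast; ring

/-- Cauchy–Schwarz against a distribution dominating the support of `a`. -/
theorem IsDist.sq_sum_abs_le {B : Type*} [Fintype B] {Q : B → ℝ} (hQ : IsDist Q) {a : B → ℝ}
    (ha : ∀ y, Q y = 0 → a y = 0) : (∑ y, |a y|) ^ 2 ≤ ∑ y, (Q y)⁻¹ * a y ^ 2 := by
  have h := sum_sq_le_sum_mul_sum_of_sq_le_mul univ (r := fun y => |a y|)
    (f := fun y => (Q y)⁻¹ * a y ^ 2) (g := Q)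
    (fun y _ => mul_nonneg (inv_nonneg.2 (hQ.1 y)) (sq_nonneg _)) (fun y _ => hQ.1 y)
    (fun y _ => by
      rw [sq_abs]
      by_cases hy : Q y = 0
      · simp [hy, ha y hy]
      · exact le_of_eq (by field_simp))
  rwa [hQ.2, mul_one] at h

theorem partialResp_eq_sum_mul {A B : Type*} [Fintype A] [Fintype B] (P : A → ℝ)
    (W : A → B → ℝ) (S : Set (A × B)) (y : B) :
    partialResp P W S y =
      ∑ x, P x * S.indicator (fun z : A × B => W z.1 z.2) (x, y) := by
  refine sum_congr rfl fun x _ => ?_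
  by_cases h : (x, y) ∈ S <;> simp [h]

/-- Soft covering / partial channel resolvability (Lemma 3). -/
theorem soft_covering_M_type
    {𝒳 𝒴 : Type*} [Fintype 𝒳] [Fintype 𝒴]
    (W : 𝒳 → 𝒴 → ℝ) (hW : IsChannel W)
    (Q : 𝒴 → ℝ) (hQ : IsDist Q) (γ : ℝ)
    (P : 𝒳 → ℝ) (hP : IsDist P) (M : ℕ) (hM : 1 ≤ M) :
    ∃ Pt : 𝒳 → ℝ, IsDist Pt ∧ IsMType M Pt ∧
      tvDist (partialResp Pt W {z : 𝒳 × 𝒴 | W z.1 z.2 ≤ Real.exp γ * Q z.2})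
          (partialResp P W {z : 𝒳 × 𝒴 | W z.1 z.2 ≤ Real.exp γ * Q z.2}) ≤
        (1 / 2) * Real.sqrt (Real.exp γ / M) := by
  set S : Set (𝒳 × 𝒴) := {z | W z.1 z.2 ≤ Real.exp γ * Q z.2} with hS
  set V : 𝒳 → 𝒴 → ℝ := fun x y => S.indicator (fun z : 𝒳 × 𝒴 => W z.1 z.2) (x, y) with hV
  have hV0 : ∀ x y, 0 ≤ V x y := fun x y => Set.indicator_nonneg (fun z _ => hW.1 z.1 z.2) _
  have hVW : ∀ x y, V x y ≤ W x y := fun x y =>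
    Set.indicator_le_self' (fun z _ => hW.1 z.1 z.2) _
  have hVQ : ∀ x y, V x y ≤ Real.exp γ * Q y := fun x y =>
    Set.indicator_apply_le' (fun h => h) fun _ => mul_nonneg (Real.exp_pos γ).le (hQ.1 y)
  have hVz : ∀ x y, Q y = 0 → V x y = 0 := fun x y hy =>
    le_antisymm (by simpa [hy] using hVQ x y) (hV0 x y)
  have hmoment : ∑ y, (Q y)⁻¹ * ∑ x, P x * V x y ^ 2 ≤ Real.exp γ := by
    have hpt : ∀ x y, (Q y)⁻¹ * (P x * V x y ^ 2) ≤ Real.exp γ * (P x * W x y) := by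
      intro x y
      by_cases hy : Q y = 0
      · simpa [hy] using mul_nonneg (Real.exp_pos γ).le (mul_nonneg (hP.1 x) (hW.1 x y))
      have hQy : 0 < Q y := (hQ.1 y).lt_of_ne' hy
      rw [inv_mul_le_iff₀ hQy]
      calc P x * V x y ^ 2 = P x * (V x y * V x y) := by ring
        _ ≤ P x * (Real.exp γ * Q y * W x y) :=
          mul_le_mul_of_nonneg_left (mul_le_mul (hVQ x y) (hVW x y) (hV0 x y)
            (mul_nonneg (Real.exp_pos γ).le hQy.le)) (hP.1 x)
        _ = Q y * (Real.exp γ * (P x * W x y)) := by ring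
    calc ∑ y, (Q y)⁻¹ * ∑ x, P x * V x y ^ 2
        ≤ ∑ y, ∑ x, Real.exp γ * (P x * W x y) := by
          refine sum_le_sum fun y _ => ?_
          rw [mul_sum]
          exact sum_le_sum fun x _ => hpt x y
      _ = Real.exp γ := by
          rw [sum_comm]
          simp only [← mul_sum, hW.2, mul_one, hP.2]
  obtain ⟨k, hk, hb⟩ := hP.exists_counts_sum_sq_le V (fun y => (Q y)⁻¹)
    (fun y => inv_nonneg.2 (hQ.1 y)) hmoment M
  have hM0 : (0 : ℝ) < M := by exact_mod_cast hM
  refine ⟨fun x => (k x : ℝ) / M, ⟨fun x => by positivity, ?_⟩, fun x => ⟨k x, rfl⟩, ?_⟩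
  · rw [← sum_div, ← Nat.cast_sum, hk, div_self hM0.ne']
  unfold tvDist
  refine mul_le_mul_of_nonneg_left (Real.le_sqrt_of_sq_le ?_) (by norm_num)
  simp only [partialResp_eq_sum_mul]
  change (∑ y, |∑ x, (k x : ℝ) / M * V x y - ∑ x, P x * V x y|) ^ 2 ≤ _
  refine (hQ.sq_sum_abs_le fun y hy => by simp [hVz _ y hy]).trans ?_
  have hscale : ∀ y, ∑ x, (k x : ℝ) / M * V x y - ∑ x, P x * V x y =
      (∑ x, (k x : ℝ) * V x y - M * ∑ x, P x * V x y) / M := fun y => by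
    simp only [div_mul_eq_mul_div, ← sum_div]
    field_simp
  calc ∑ y, (Q y)⁻¹ * (∑ x, (k x : ℝ) / M * V x y - ∑ x, P x * V x y) ^ 2
      = (∑ y, (Q y)⁻¹ * (∑ x, (k x : ℝ) * V x y - M * ∑ x, P x * V x y) ^ 2) / M ^ 2 := by
        simp only [hscale, div_pow, ← mul_div_assoc, sum_div]
    _ ≤ M * Real.exp γ / M ^ 2 := by gcongr
    _ = Real.exp γ / M := by field_simp
end

section
/- Let W be a channel from a finite alphabet 𝒳 to a finite alphabet 𝒴 and let 0 ≤ ε < 1. Then the minimum over input distributions P on 𝒳 of the maximum over output distributions Q on 𝒴 of β_ε(P×W, P×Q) is attained, and min_{P} max_{Q} β_ε(P×W, P×Q) = max_{Q} min_{P} β_ε(P×W, P×Q). -/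
open Finset

/-- **Von Neumann's minimax theorem**: a bilinear form has a saddle point on a product of nonempty
compact convex sets. -/
theorem exists_isSaddlePointOn_of_bilinear {E F : Type*}
    [AddCommGroup E] [Module ℝ E] [TopologicalSpace E] [IsTopologicalAddGroup E]
    [ContinuousSMul ℝ E] [T2Space E] [FiniteDimensional ℝ E]
    [AddCommGroup F] [Module ℝ F] [TopologicalSpace F] [IsTopologicalAddGroup F]
    [ContinuousSMul ℝ F] [T2Space F] [FiniteDimensional ℝ F]
    (B : E →ₗ[ℝ] F →ₗ[ℝ] ℝ) {K : Set E} {L : Set F}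
    (hK : K.Nonempty) (hKconv : Convex ℝ K) (hKcomp : IsCompact K)
    (hL : L.Nonempty) (hLconv : Convex ℝ L) (hLcomp : IsCompact L) :
    ∃ a ∈ K, ∃ b ∈ L, IsSaddlePointOn K L (fun x y => B x y) a b :=
  Sion.exists_isSaddlePointOn' hK hKcomp
    (fun y _ => (B.flip y).continuous_of_finiteDimensional.lowerSemicontinuous.lowerSemicontinuousOn
      K)
    (fun y _ => ((B.flip y).convexOn hKconv).quasiconvexOn)
    hLconv hLcomp
    (fun x _ => (B x).continuous_of_finiteDimensional.upperSemicontinuous.upperSemicontinuousOn L)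
    (fun x _ => ((B x).concaveOn hLconv).quasiconcaveOn)
    hKconv hL

/-- A saddle point on `S × T` yields attainment of the min-max and equality with the max-min. -/
theorem IsSaddlePointOn.sInf_sSup_eq_sSup_sInf {E F : Type*} {S : Set E} {T : Set F}
    {f : E → F → ℝ} {a : E} {b : F} (h : IsSaddlePointOn S T f a b) (ha : a ∈ S) (hb : b ∈ T)
    (habove : ∀ x ∈ S, BddAbove {w | ∃ y, y ∈ T ∧ w = f x y})
    (hbelow : ∀ y ∈ T, BddBelow {v | ∃ x, x ∈ S ∧ v = f x y}) :
    (∀ x ∈ S, sSup {w | ∃ y, y ∈ T ∧ w = f a y} ≤ sSup {w | ∃ y, y ∈ T ∧ w = f x y}) ∧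
      sInf {v | ∃ x, x ∈ S ∧ v = sSup {w | ∃ y, y ∈ T ∧ w = f x y}} =
        sSup {w | ∃ y, y ∈ T ∧ w = sInf {v | ∃ x, x ∈ S ∧ v = f x y}} := by
  have hsup : sSup {w | ∃ y, y ∈ T ∧ w = f a y} = f a b :=
    IsGreatest.csSup_eq ⟨⟨b, hb, rfl⟩, by rintro _ ⟨y, hy, rfl⟩; exact h a ha y hy⟩
  have hinf : sInf {v | ∃ x, x ∈ S ∧ v = f x b} = f a b :=
    IsLeast.csInf_eq ⟨⟨a, ha, rfl⟩, by rintro _ ⟨x, hx, rfl⟩; exact h x hx b hb⟩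
  have hle : ∀ x ∈ S, f a b ≤ sSup {w | ∃ y, y ∈ T ∧ w = f x y} := fun x hx =>
    (h x hx b hb).trans (le_csSup (habove x hx) ⟨b, hb, rfl⟩)
  have hge : ∀ y ∈ T, sInf {v | ∃ x, x ∈ S ∧ v = f x y} ≤ f a b := fun y hy =>
    (csInf_le (hbelow y hy) ⟨a, ha, rfl⟩).trans (h a ha y hy)
  refine ⟨fun x hx => hsup.trans_le (hle x hx), ?_⟩
  have hminmax : IsLeast {v | ∃ x, x ∈ S ∧ v = sSup {w | ∃ y, y ∈ T ∧ w = f x y}} (f a b) :=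
    ⟨⟨a, ha, hsup.symm⟩, by rintro _ ⟨x, hx, rfl⟩; exact hle x hx⟩
  have hmaxmin : IsGreatest {w | ∃ y, y ∈ T ∧ w = sInf {v | ∃ x, x ∈ S ∧ v = f x y}} (f a b) :=
    ⟨⟨b, hb, hinf.symm⟩, by rintro _ ⟨y, hy, rfl⟩; exact hge y hy⟩
  rw [hminmax.csInf_eq, hmaxmin.csSup_eq]

section betaErr

variable {Z : Type*} [Fintype Z] {ε : ℝ} {p q t : Z → ℝ}

theorem betaErr_le (hq : ∀ z, 0 ≤ q z) (ht : ∀ z, 0 ≤ t z ∧ t z ≤ 1)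
    (hp : ∑ z, p z * (1 - t z) ≤ ε) : betaErr ε p q ≤ ∑ z, q z * t z := by
  refine csInf_le ⟨0, ?_⟩ ⟨t, ht, hp, rfl⟩
  rintro _ ⟨s, hs, -, rfl⟩
  exact Finset.sum_nonneg fun z _ => mul_nonneg (hq z) (hs z).1

theorem le_betaErr (hε : 0 ≤ ε) {v : ℝ}
    (h : ∀ t : Z → ℝ, (∀ z, 0 ≤ t z ∧ t z ≤ 1) → ∑ z, p z * (1 - t z) ≤ ε →
      v ≤ ∑ z, q z * t z) : v ≤ betaErr ε p q := by
  refine le_csInf ⟨_, fun _ => 1, by simp, by simpa using hε, rfl⟩ ?_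
  rintro _ ⟨t, ht, hp, rfl⟩
  exact h t ht hp

theorem betaErr_nonneg (hε : 0 ≤ ε) (hq : ∀ z, 0 ≤ q z) : 0 ≤ betaErr ε p q :=
  le_betaErr hε fun _ ht _ => Finset.sum_nonneg fun z _ => mul_nonneg (hq z) (ht z).1

theorem betaErr_le_sum (hε : 0 ≤ ε) (hq : ∀ z, 0 ≤ q z) : betaErr ε p q ≤ ∑ z, q z := by
  simpa using betaErr_le (p := p) (t := fun _ => 1) hq (by simp) (by simpa using hε)

end betaErr

theorem IsDist.prod {A B : Type*} [Fintype A] [Fintype B] {P : A → ℝ} {Q : B → ℝ}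
    (hP : IsDist P) (hQ : IsDist Q) : IsDist fun z : A × B => P z.1 * Q z.2 :=
  ⟨fun z => mul_nonneg (hP.1 z.1) (hQ.1 z.2), by
    rw [Fintype.sum_prod_type, ← Fintype.sum_mul_sum, hP.2, hQ.2, one_mul]⟩

section weightedTests

variable {A B : Type*} [Fintype A] [Fintype B]

/-- Pairs `(P, s)` of an input distribution and a weighted test `s(x,y) = P(x) t(x,y)`
of type I error at most `ε`; unlike the pairs `(P, t)`, they form a convex set. -/
def weightedTests (W : A → B → ℝ) (ε : ℝ) : Set ((A → ℝ) × (A × B → ℝ)) :=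
  {u | u.1 ∈ stdSimplex ℝ A ∧ (∀ z, 0 ≤ u.2 z ∧ u.2 z ≤ u.1 z.1) ∧
    ∑ z : A × B, W z.1 z.2 * (u.1 z.1 - u.2 z) ≤ ε}

variable {W : A → B → ℝ} {ε : ℝ}

theorem convex_weightedTests : Convex ℝ (weightedTests W ε) := by
  rintro ⟨P, s⟩ ⟨hP, hs, hW⟩ ⟨P', s'⟩ ⟨hP', hs', hW'⟩ a b ha hb hab
  refine ⟨convex_stdSimplex ℝ A hP hP' ha hb hab, fun z => ⟨?_, ?_⟩, ?_⟩
  · exact add_nonneg (mul_nonneg ha (hs z).1) (mul_nonneg hb (hs' z).1)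
  · exact add_le_add (mul_le_mul_of_nonneg_left (hs z).2 ha)
      (mul_le_mul_of_nonneg_left (hs' z).2 hb)
  · calc ∑ z : A × B, W z.1 z.2 * ((a * P z.1 + b * P' z.1) - (a * s z + b * s' z))
        = a * ∑ z : A × B, W z.1 z.2 * (P z.1 - s z) +
          b * ∑ z : A × B, W z.1 z.2 * (P' z.1 - s' z) := by
          simp only [Finset.mul_sum, ← Finset.sum_add_distrib]
          exact Finset.sum_congr rfl fun z _ => by ring
      _ ≤ a * ε + b * ε :=
        add_le_add (mul_le_mul_of_nonneg_left hW ha) (mul_le_mul_of_nonneg_left hW' hb)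
      _ = ε := by rw [← add_mul, hab, one_mul]

theorem isCompact_weightedTests : IsCompact (weightedTests W ε) := by
  refine ((isCompact_stdSimplex ℝ A).prod (isCompact_Icc (a := (0 : A × B → ℝ))
    (b := 1))).of_isClosed_subset ?_ ?_
  · have hbounds : IsClosed {u : (A → ℝ) × (A × B → ℝ) |
        ∀ z, 0 ≤ u.2 z ∧ u.2 z ≤ u.1 z.1} := by
      simp only [Set.ofPred_forall, Set.ofPred_and]
      exact isClosed_iInter fun z =>
        (isClosed_le (by fun_prop) (by fun_prop)).inter (isClosed_le (by fun_prop) (by fun_prop))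
    have herror : IsClosed {u : (A → ℝ) × (A × B → ℝ) |
        ∑ z : A × B, W z.1 z.2 * (u.1 z.1 - u.2 z) ≤ ε} :=
      isClosed_le (by fun_prop) (by fun_prop)
    exact ((isClosed_stdSimplex ℝ A).preimage continuous_fst).inter (hbounds.inter herror)
  · rintro ⟨P, s⟩ ⟨hP, hs, -⟩
    exact ⟨hP, fun z => (hs z).1,
      fun z => (hs z).2.trans (mem_Icc_of_mem_stdSimplex hP z.1).2⟩

theorem mem_weightedTests {P : A → ℝ} (hP : IsDist P) {t : A × B → ℝ}
    (ht : ∀ z, 0 ≤ t z ∧ t z ≤ 1)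
    (hε : ∑ z : A × B, P z.1 * W z.1 z.2 * (1 - t z) ≤ ε) :
    (P, fun z => P z.1 * t z) ∈ weightedTests W ε := by
  refine ⟨hP, fun z => ⟨mul_nonneg (hP.1 z.1) (ht z).1,
    mul_le_of_le_one_right (hP.1 z.1) (ht z).2⟩, le_of_eq_of_le ?_ hε⟩
  exact Finset.sum_congr rfl fun z _ => by ring

theorem betaErr_le_of_mem_weightedTests {P : A → ℝ} {s : A × B → ℝ}
    (h : (P, s) ∈ weightedTests W ε) {Q : B → ℝ} (hQ : IsDist Q) :
    betaErr ε (fun z : A × B => P z.1 * W z.1 z.2) (fun z : A × B => P z.1 * Q z.2) ≤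
      ∑ z : A × B, s z * Q z.2 := by
  obtain ⟨hP, hs, hW⟩ := h
  have hmul : ∀ z, P z.1 * (s z / P z.1) = s z := fun z =>
    mul_div_cancel_of_imp' fun h0 => le_antisymm (h0 ▸ (hs z).2) (hs z).1
  refine (betaErr_le (t := fun z => s z / P z.1) (IsDist.prod hP hQ).1
    (fun z => ⟨div_nonneg (hs z).1 (hP.1 z.1), div_le_one_of_le₀ (hs z).2 (hP.1 z.1)⟩)
    (le_of_eq_of_le ?_ hW)).trans_eq ?_
  · refine Finset.sum_congr rfl fun z _ => ?_
    linear_combination -W z.1 z.2 * hmul z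
  · refine Finset.sum_congr rfl fun z _ => ?_
    linear_combination Q z.2 * hmul z

/-- The pairing `((P, s), Q) ↦ ∑ s(x,y) Q(y)`, the type II error of a weighted test. -/
noncomputable def typeIIError :
    ((A → ℝ) × (A × B → ℝ)) →ₗ[ℝ] (B → ℝ) →ₗ[ℝ] ℝ :=
  LinearMap.mk₂ ℝ (fun u Q => ∑ z : A × B, u.2 z * Q z.2)
    (fun u u' Q => by simp [add_mul, Finset.sum_add_distrib])
    (fun c u Q => by simp [Finset.mul_sum, mul_assoc])
    (fun u Q Q' => by simp [mul_add, Finset.sum_add_distrib])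
    (fun c u Q => by simp [Finset.mul_sum, mul_left_comm])

theorem exists_isSaddlePointOn_betaErr [Nonempty A] [Nonempty B] (hε : 0 ≤ ε) :
    ∃ P₀ ∈ {P : A → ℝ | IsDist P}, ∃ Q₀ ∈ {Q : B → ℝ | IsDist Q},
      IsSaddlePointOn {P : A → ℝ | IsDist P} {Q : B → ℝ | IsDist Q}
        (fun P Q => betaErr ε (fun z : A × B => P z.1 * W z.1 z.2)
          (fun z : A × B => P z.1 * Q z.2)) P₀ Q₀ := by
  classical
  have hA : IsDist (Pi.single (Classical.arbitrary A) 1 : A → ℝ) := single_mem_stdSimplex ℝ _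
  obtain ⟨⟨P₀, s₀⟩, h₀, Q₀, hQ₀, h⟩ := exists_isSaddlePointOn_of_bilinear typeIIError
    ⟨_, mem_weightedTests (W := W) (ε := ε) (t := fun _ => 1) hA (by simp) (by simpa using hε)⟩
    convex_weightedTests isCompact_weightedTests
    ⟨_, single_mem_stdSimplex ℝ (Classical.arbitrary B)⟩
    (convex_stdSimplex ℝ B) (isCompact_stdSimplex ℝ B)
  refine ⟨P₀, h₀.1, Q₀, hQ₀, fun P hP Q hQ => ?_⟩
  refine (betaErr_le_of_mem_weightedTests h₀ hQ).trans (le_betaErr hε fun t ht htε => ?_)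
  refine (h _ (mem_weightedTests hP ht htε) Q hQ).trans_eq ?_
  exact Finset.sum_congr rfl fun z _ => mul_right_comm _ _ _

end weightedTests

/-- Minimax property of the hypothesis testing error over input/output
distributions (Lemma 2). -/
theorem minimax_beta
    {𝒳 𝒴 : Type*} [Fintype 𝒳] [Fintype 𝒴] [Nonempty 𝒳] [Nonempty 𝒴]
    (W : 𝒳 → 𝒴 → ℝ) (hW : IsChannel W) (ε : ℝ) (hε : 0 ≤ ε) (hε1 : ε < 1) :
    (∃ P₀ : 𝒳 → ℝ, IsDist P₀ ∧ ∀ P : 𝒳 → ℝ, IsDist P →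
        sSup {w : ℝ | ∃ Q : 𝒴 → ℝ, IsDist Q ∧
            w = betaErr ε (fun z : 𝒳 × 𝒴 => P₀ z.1 * W z.1 z.2)
              (fun z : 𝒳 × 𝒴 => P₀ z.1 * Q z.2)} ≤
          sSup {w : ℝ | ∃ Q : 𝒴 → ℝ, IsDist Q ∧
            w = betaErr ε (fun z : 𝒳 × 𝒴 => P z.1 * W z.1 z.2)
              (fun z : 𝒳 × 𝒴 => P z.1 * Q z.2)}) ∧
      sInf {v : ℝ | ∃ P : 𝒳 → ℝ, IsDist P ∧
          v = sSup {w : ℝ | ∃ Q : 𝒴 → ℝ, IsDist Q ∧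
            w = betaErr ε (fun z : 𝒳 × 𝒴 => P z.1 * W z.1 z.2)
              (fun z : 𝒳 × 𝒴 => P z.1 * Q z.2)}} =
        sSup {w : ℝ | ∃ Q : 𝒴 → ℝ, IsDist Q ∧
          w = sInf {v : ℝ | ∃ P : 𝒳 → ℝ, IsDist P ∧
            v = betaErr ε (fun z : 𝒳 × 𝒴 => P z.1 * W z.1 z.2)
              (fun z : 𝒳 × 𝒴 => P z.1 * Q z.2)}} := by
  obtain ⟨P₀, hP₀, Q₀, hQ₀, h⟩ := exists_isSaddlePointOn_betaErr (W := W) hε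
  have key := h.sInf_sSup_eq_sSup_sInf hP₀ hQ₀
    (fun P hP => ⟨1, by
      rintro _ ⟨Q, hQ, rfl⟩
      exact (betaErr_le_sum hε (IsDist.prod hP hQ).1).trans_eq (IsDist.prod hP hQ).2⟩)
    (fun Q hQ => ⟨0, by
      rintro _ ⟨P, hP, rfl⟩
      exact betaErr_nonneg hε (IsDist.prod hP hQ).1⟩)
  exact ⟨⟨P₀, hP₀, key.1⟩, key.2⟩
end
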